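/- arXiv:2212.13459 — 2 statements merged into one kernel-verified Lean document; each statement's English description precedes it below -/
import Mathlib

section
/- (Locality of the style loss gradient.) Let n_p, n_c be positive integers, let w, w', w'' ≥ 0 be weights, let G_s ∈ ℝ^{n_c×n_c} be symmetric and μ_s, σ_s ∈ ℝ^{n_c}, and define the augmented style loss Ẽ(V) = w ‖G(V) − G_s‖_F² + w' ‖mean(V) − μ_s‖² + w'' ‖std(V) − σ_s‖². Let V, W ∈ ℝ^{n_p×n_c} satisfy std(V)_j > 0 and std(W)_j > 0 for all channels j, and suppose G(V) = G(W), mean(V) = mean(W) and std(V) = std(W). Then for every pixel index k ∈ {1,…,n_p} such that the k-th rows of V and W coincide, the k-th rows of the gradients ∇Ẽ(V) and ∇Ẽ(W) (with respect to the Frobenius inner product) coincide. -/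
/-- Gram matrix `G(V) = (1/n_p) Vᵀ V` of a feature matrix. -/
noncomputable def gramMatrix (np nc : ℕ) (V : Fin np → Fin nc → ℝ) :
    Fin nc → Fin nc → ℝ :=
  fun i j => (1 / (np : ℝ)) * ∑ k, V k i * V k j

/-- Channel-wise mean of a feature matrix. -/
noncomputable def featMean (np nc : ℕ) (V : Fin np → Fin nc → ℝ) : Fin nc → ℝ :=
  fun j => (1 / (np : ℝ)) * ∑ k, V k j

/-- Channel-wise standard deviation of a feature matrix. -/
noncomputable def featStd (np nc : ℕ) (V : Fin np → Fin nc → ℝ) : Fin nc → ℝ :=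
  fun j => Real.sqrt ((1 / (np : ℝ)) * ∑ k, (V k j - featMean np nc V j) ^ 2)

/-- Augmented style loss
`Ẽ(V) = w ‖G(V) − G_s‖_F² + w' ‖mean(V) − μ_s‖² + w'' ‖std(V) − σ_s‖²`. -/
noncomputable def styleLoss (np nc : ℕ) (w w' w'' : ℝ)
    (Gs : Fin nc → Fin nc → ℝ) (μs σs : Fin nc → ℝ)
    (V : Fin np → Fin nc → ℝ) : ℝ :=
  w * ∑ i, ∑ j, (gramMatrix np nc V i j - Gs i j) ^ 2
    + w' * ∑ j, (featMean np nc V j - μs j) ^ 2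
    + w'' * ∑ j, (featStd np nc V j - σs j) ^ 2

theorem sum_row_change {np nc : ℕ} (φ : (Fin nc → ℝ) → ℝ) (V W D : Fin np → Fin nc → ℝ)
    (k : Fin np) (hk : V k = W k) (hD : ∀ l, l ≠ k → D l = 0)
    (h : ∑ l, φ (V l) = ∑ l, φ (W l)) :
    ∑ l, φ ((V + D) l) = ∑ l, φ ((W + D) l) := by
  have key : ∀ U : Fin np → Fin nc → ℝ,
      ∑ l, φ ((U + D) l) = ∑ l, φ (U l) + (φ (U k + D k) - φ (U k)) := by
    intro U
    rw [← sub_eq_iff_eq_add', ← Finset.sum_sub_distrib]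
    refine Finset.sum_eq_single k (fun l _ hl => ?_) (fun h => absurd (Finset.mem_univ k) h)
    simp [hD l hl]
  rw [key V, key W, h, hk]

theorem featStd_eq (np nc : ℕ) (hnp : 0 < np) (V : Fin np → Fin nc → ℝ) (j : Fin nc) :
    featStd np nc V j = Real.sqrt (gramMatrix np nc V j j - featMean np nc V j ^ 2) := by
  unfold featStd
  congr 1
  have hn : (np : ℝ) ≠ 0 := by positivity
  have hs : ∑ k, V k j = np * featMean np nc V j := by
    unfold featMean; field_simp
  have : ∀ k, (V k j - featMean np nc V j) ^ 2
      = V k j * V k j - 2 * featMean np nc V j * V k j + featMean np nc V j ^ 2 := by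
    intro k; ring
  simp only [this, Finset.sum_add_distrib, Finset.sum_sub_distrib, ← Finset.mul_sum, hs]
  simp only [Finset.sum_const, Finset.card_univ, Fintype.card_fin, nsmul_eq_mul, gramMatrix]
  field_simp
  ring

theorem styleLoss_diff (np nc : ℕ) (w w' w'' : ℝ)
    (Gs : Fin nc → Fin nc → ℝ) (μs σs : Fin nc → ℝ) (V : Fin np → Fin nc → ℝ)
    (hV : ∀ j, 0 < featStd np nc V j) :
    DifferentiableAt ℝ (styleLoss np nc w w' w'' Gs μs σs) V := by
  have hc : ∀ l j, DifferentiableAt ℝ (fun U : Fin np → Fin nc → ℝ => U l j) V := by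
    intro l j; fun_prop
  have hm : ∀ j, DifferentiableAt ℝ (fun U => featMean np nc U j) V := by
    intro j; unfold featMean; fun_prop
  have hg : ∀ i j, DifferentiableAt ℝ (fun U => gramMatrix np nc U i j) V := by
    intro i j; unfold gramMatrix; fun_prop
  have hs : ∀ j, DifferentiableAt ℝ (fun U => featStd np nc U j) V := by
    intro j
    have h := hV j
    unfold featStd at h ⊢
    refine DifferentiableAt.sqrt ?_ (Real.sqrt_pos.1 h).ne'
    have := hm j
    fun_prop
  unfold styleLoss
  fun_prop

/-- Locality of the style loss gradient: if `V` and `W` have the same Gram matrix,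
mean and std (all positive), then at every pixel `k` where the rows of `V` and `W`
coincide, the `k`-th rows of the gradients of the augmented style loss coincide.
(Gradient entries w.r.t. the Frobenius inner product are recovered by applying the
Fréchet derivative to the elementary matrices `Pi.single k (Pi.single j 1)`.) -/
theorem style_loss_gradient_local (np nc : ℕ) (hnp : 0 < np) (hnc : 0 < nc)
    (w w' w'' : ℝ) (hw : 0 ≤ w) (hw' : 0 ≤ w') (hw'' : 0 ≤ w'')
    (Gs : Fin nc → Fin nc → ℝ) (hGs : ∀ i j, Gs i j = Gs j i)
    (μs σs : Fin nc → ℝ)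
    (V W : Fin np → Fin nc → ℝ)
    (hVstd : ∀ j, 0 < featStd np nc V j) (hWstd : ∀ j, 0 < featStd np nc W j)
    (hgram : ∀ i j, gramMatrix np nc V i j = gramMatrix np nc W i j)
    (hmean : ∀ j, featMean np nc V j = featMean np nc W j)
    (hstd : ∀ j, featStd np nc V j = featStd np nc W j) :
    DifferentiableAt ℝ (styleLoss np nc w w' w'' Gs μs σs) V ∧
    DifferentiableAt ℝ (styleLoss np nc w w' w'' Gs μs σs) W ∧
    ∀ k : Fin np, (∀ j, V k j = W k j) →
      ∀ j : Fin nc,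
        fderiv ℝ (styleLoss np nc w w' w'' Gs μs σs) V
            (Pi.single k (Pi.single j (1 : ℝ)))
          = fderiv ℝ (styleLoss np nc w w' w'' Gs μs σs) W
              (Pi.single k (Pi.single j (1 : ℝ))) := by
  have dV := styleLoss_diff np nc w w' w'' Gs μs σs V hVstd
  have dW := styleLoss_diff np nc w w' w'' Gs μs σs W hWstd
  refine ⟨dV, dW, fun k hk j => ?_⟩
  rw [← dV.lineDeriv_eq_fderiv, ← dW.lineDeriv_eq_fderiv]
  unfold lineDeriv
  congr 1
  funext t
  have hn : (np : ℝ) ≠ 0 := by positivity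
  set D : Fin np → Fin nc → ℝ := t • Pi.single k (Pi.single j (1 : ℝ)) with hDdef
  have hD : ∀ l, l ≠ k → D l = 0 := by
    intro l hl
    simp [hDdef, hl]
  have hk' : V k = W k := funext hk
  have hg : ∀ a b, gramMatrix np nc (V + D) a b = gramMatrix np nc (W + D) a b := by
    intro a b
    have h := hgram a b
    unfold gramMatrix at h ⊢
    congr 1
    exact sum_row_change (fun r => r a * r b) V W D k hk' hD
      (mul_left_cancel₀ (one_div_ne_zero hn) h)
  have hm : ∀ a, featMean np nc (V + D) a = featMean np nc (W + D) a := by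
    intro a
    have h := hmean a
    unfold featMean at h ⊢
    congr 1
    exact sum_row_change (fun r => r a) V W D k hk' hD
      (mul_left_cancel₀ (one_div_ne_zero hn) h)
  have hs : ∀ a, featStd np nc (V + D) a = featStd np nc (W + D) a := by
    intro a
    rw [featStd_eq np nc hnp, featStd_eq np nc hnp, hg, hm]
  simp only [styleLoss, hg, hm, hs]
end

section
/- (Explicit per-pixel gradient of the augmented style loss.) Let n_p, n_c be positive integers, let w, w', w'' ≥ 0 be weights, let G_s ∈ ℝ^{n_c×n_c} be symmetric and μ_s, σ_s ∈ ℝ^{n_c}, and define Ẽ(V) = w ‖G(V) − G_s‖_F² + w' ‖mean(V) − μ_s‖² + w'' ‖std(V) − σ_s‖². Let V ∈ ℝ^{n_p×n_c} satisfy std(V)_j > 0 for all channels j. Then Ẽ is differentiable at V and for every pixel index k ∈ {1,…,n_p} and channel j ∈ {1,…,n_c}, the (k,j) entry of its gradient with respect to the Frobenius inner product equals (4w/n_p) · ((G(V) − G_s) V_k)_j + (2w'/n_p) · (mean(V)_j − μ_{s,j}) + (2w''/n_p) · (V_{k,j} − mean(V)_j) · (std(V)_j − σ_{s,j}) / std(V)_j,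 where V_k ∈ ℝ^{n_c} is the k-th row of V. In particular, given the global statistics G(V), mean(V), std(V), the k-th row of the gradient depends on V only through V_k. -/
/-- The coordinate functional `V ↦ V k j`. -/
noncomputable def coordL (np nc : ℕ) (k : Fin np) (j : Fin nc) :
    (Fin np → Fin nc → ℝ) →L[ℝ] ℝ :=
  (ContinuousLinearMap.proj (R := ℝ) (φ := fun _ : Fin nc => ℝ) j).comp
    (ContinuousLinearMap.proj (R := ℝ) (φ := fun _ : Fin np => Fin nc → ℝ) k)

theorem coordL_apply (np nc : ℕ) (k : Fin np) (j : Fin nc) (H : Fin np → Fin nc → ℝ) :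
    coordL np nc k j H = H k j := rfl

theorem hasFDerivAt_coord (np nc : ℕ) (k : Fin np) (j : Fin nc) (V : Fin np → Fin nc → ℝ) :
    HasFDerivAt (fun V : Fin np → Fin nc → ℝ => V k j) (coordL np nc k j) V :=
  (coordL np nc k j).hasFDerivAt

theorem mean_fderiv (np nc : ℕ) (V : Fin np → Fin nc → ℝ) (j : Fin nc) :
    ∃ F : (Fin np → Fin nc → ℝ) →L[ℝ] ℝ,
      HasFDerivAt (fun V => featMean np nc V j) F V ∧ ∀ H, F H = featMean np nc H j := by
  refine ⟨_, (HasFDerivAt.fun_sum (u := Finset.univ)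
    (fun k _ => hasFDerivAt_coord np nc k j V)).const_mul (1 / (np : ℝ)), fun H => ?_⟩
  simp [featMean, coordL_apply]

theorem gram_fderiv (np nc : ℕ) (V : Fin np → Fin nc → ℝ) (i j : Fin nc) :
    ∃ F : (Fin np → Fin nc → ℝ) →L[ℝ] ℝ,
      HasFDerivAt (fun V => gramMatrix np nc V i j) F V ∧
      ∀ H, F H = (1 / (np : ℝ)) * ∑ k, (V k i * H k j + V k j * H k i) := by
  refine ⟨_, (HasFDerivAt.fun_sum (u := Finset.univ)
    (fun k _ => (hasFDerivAt_coord np nc k i V).mul (hasFDerivAt_coord np nc k j V))).const_mul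
      (1 / (np : ℝ)), fun H => ?_⟩
  simp [coordL_apply]

theorem sum_centered (np nc : ℕ) (hnp : 0 < np) (V : Fin np → Fin nc → ℝ) (j : Fin nc) :
    ∑ k, (V k j - featMean np nc V j) = 0 := by
  have : (np : ℝ) ≠ 0 := by positivity
  simp [featMean, Finset.sum_sub_distrib]
  field_simp
  simp

theorem std_fderiv (np nc : ℕ) (hnp : 0 < np) (V : Fin np → Fin nc → ℝ) (j : Fin nc)
    (h : 0 < featStd np nc V j) :
    ∃ F : (Fin np → Fin nc → ℝ) →L[ℝ] ℝ,
      HasFDerivAt (fun V => featStd np nc V j) F V ∧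
      ∀ H, F H = (1 / featStd np nc V j) *
        ((1 / (np : ℝ)) * ∑ k, (V k j - featMean np nc V j) * H k j) := by
  obtain ⟨M, hM, hMe⟩ := mean_fderiv np nc V j
  have h0 : (1 / (np : ℝ)) * ∑ k, (V k j - featMean np nc V j) ^ 2 ≠ 0 :=
    (Real.sqrt_pos.mp h).ne'
  refine ⟨_, ((HasFDerivAt.fun_sum (u := Finset.univ)
    (fun k _ => ((hasFDerivAt_coord np nc k j V).sub hM).pow 2)).const_mul
      (1 / (np : ℝ))).sqrt h0, fun H => ?_⟩
  have e : ∑ k, (V k j - featMean np nc V j) * (H k j - featMean np nc H j)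
      = ∑ k, (V k j - featMean np nc V j) * H k j := by
    simp only [mul_sub, Finset.sum_sub_distrib]
    rw [← Finset.sum_mul, sum_centered np nc hnp V j]
    simp
  rw [← e]
  have e2 : ∑ k, 2 * (V k j - featMean np nc V j) * (H k j - featMean np nc H j)
      = 2 * ∑ k, (V k j - featMean np nc V j) * (H k j - featMean np nc H j) := by
    rw [Finset.mul_sum]
    exact Finset.sum_congr rfl fun _ _ => by ring
  change _ = (1 / Real.sqrt ((1 / (np : ℝ)) * ∑ k, (V k j - featMean np nc V j) ^ 2)) * _
  simp only [ContinuousLinearMap.smul_apply, ContinuousLinearMap.sum_apply,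
    ContinuousLinearMap.sub_apply, Pi.sub_apply, coordL_apply, hMe, smul_eq_mul, nsmul_eq_mul,
    Nat.cast_ofNat, Nat.add_one_sub_one, pow_one]
  rw [e2]
  ring

theorem loss_fderiv (np nc : ℕ) (hnp : 0 < np) (w w' w'' : ℝ)
    (Gs : Fin nc → Fin nc → ℝ) (μs σs : Fin nc → ℝ) (V : Fin np → Fin nc → ℝ)
    (hstd : ∀ j, 0 < featStd np nc V j) :
    ∃ F : (Fin np → Fin nc → ℝ) →L[ℝ] ℝ,
      HasFDerivAt (styleLoss np nc w w' w'' Gs μs σs) F V ∧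
      ∀ H, F H = w * (∑ i, ∑ j, 2 * (gramMatrix np nc V i j - Gs i j) *
            ((1 / (np : ℝ)) * ∑ k, (V k i * H k j + V k j * H k i)))
        + w' * (∑ j, 2 * (featMean np nc V j - μs j) * featMean np nc H j)
        + w'' * (∑ j, 2 * (featStd np nc V j - σs j) * ((1 / featStd np nc V j) *
        ((1 / (np : ℝ)) * ∑ k, (V k j - featMean np nc V j) * H k j))) := by
  choose M hM hMe using mean_fderiv np nc V
  choose G hG hGe using gram_fderiv np nc V
  choose S hS hSe using fun j => std_fderiv np nc hnp V j (hstd j)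
  refine ⟨_, (((HasFDerivAt.fun_sum (u := Finset.univ) (fun i _ =>
      HasFDerivAt.fun_sum (u := Finset.univ) (fun j _ =>
        ((hG i j).sub_const (Gs i j)).pow 2))).const_mul w).add
    ((HasFDerivAt.fun_sum (u := Finset.univ) (fun j _ =>
        ((hM j).sub_const (μs j)).pow 2)).const_mul w')).add
    ((HasFDerivAt.fun_sum (u := Finset.univ) (fun j _ =>
        ((hS j).sub_const (σs j)).pow 2)).const_mul w''), fun H => ?_⟩
  simp only [ContinuousLinearMap.smul_apply, ContinuousLinearMap.sum_apply,
    ContinuousLinearMap.add_apply, hMe, hGe, hSe, smul_eq_mul, nsmul_eq_mul,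
    Nat.cast_ofNat, Nat.add_one_sub_one, pow_one]

/-- Explicit per-pixel gradient of the augmented style loss: `Ẽ` is differentiable at any
`V` with positive channel-wise std, and the `(k,j)` entry of its gradient w.r.t. the
Frobenius inner product (recovered by applying the Fréchet derivative to the elementary
matrix `Pi.single k (Pi.single j 1)`) equals
`(4w/n_p)((G(V) − G_s) V_k)_j + (2w'/n_p)(mean(V)_j − μ_{s,j})
  + (2w''/n_p)(V_{k,j} − mean(V)_j)(std(V)_j − σ_{s,j})/std(V)_j`;
in particular, given the global statistics, the `k`-th row of the gradient depends on `V`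
only through its `k`-th row `V_k`. -/
theorem style_loss_gradient_entries (np nc : ℕ) (hnp : 0 < np) (hnc : 0 < nc)
    (w w' w'' : ℝ) (hw : 0 ≤ w) (hw' : 0 ≤ w') (hw'' : 0 ≤ w'')
    (Gs : Fin nc → Fin nc → ℝ) (hGs : ∀ i j, Gs i j = Gs j i)
    (μs σs : Fin nc → ℝ)
    (V : Fin np → Fin nc → ℝ)
    (hstd : ∀ j, 0 < featStd np nc V j) :
    DifferentiableAt ℝ (styleLoss np nc w w' w'' Gs μs σs) V ∧
    ∀ (k : Fin np) (j : Fin nc),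
      fderiv ℝ (styleLoss np nc w w' w'' Gs μs σs) V
          (Pi.single k (Pi.single j (1 : ℝ)))
        = (4 * w / (np : ℝ)) * (∑ i, (gramMatrix np nc V j i - Gs j i) * V k i)
          + (2 * w' / (np : ℝ)) * (featMean np nc V j - μs j)
          + (2 * w'' / (np : ℝ)) * (V k j - featMean np nc V j)
              * (featStd np nc V j - σs j) / featStd np nc V j := by
  obtain ⟨F, hF, hFe⟩ := loss_fderiv np nc hnp w w' w'' Gs μs σs V hstd
  refine ⟨hF.differentiableAt, fun k j => ?_⟩
  rw [hF.fderiv, hFe]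
  have hs : ∀ (a : Fin np) (b : Fin nc),
      (Pi.single k (Pi.single j (1 : ℝ)) : Fin np → Fin nc → ℝ) a b
        = if a = k then (if b = j then 1 else 0) else 0 := by
    intro a b
    by_cases h : a = k
    · subst h; simp [Pi.single_apply]
    · simp [h]
  have hsym : ∀ a b, gramMatrix np nc V a b = gramMatrix np nc V b a := fun a b => by
    simp only [gramMatrix, mul_comm]
  have hg : ∑ a, ∑ b, 2 * (gramMatrix np nc V a b - Gs a b) * ((1 / (np : ℝ)) *
      ∑ c, (V c a * (if c = k then (if b = j then (1 : ℝ) else 0) else 0)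
        + V c b * (if c = k then (if a = j then (1 : ℝ) else 0) else 0)))
      = (4 / (np : ℝ)) * ∑ i, (gramMatrix np nc V j i - Gs j i) * V k i := by
    simp only [Finset.sum_add_distrib, mul_add, mul_ite, mul_one, mul_zero,
      Finset.sum_ite_eq', Finset.mem_univ, if_true]
    rw [Finset.sum_comm (f := fun a b => if a = j then _ else _)]
    simp only [Finset.sum_ite_eq', Finset.mem_univ, if_true]
    rw [← Finset.sum_add_distrib, Finset.mul_sum]
    refine Finset.sum_congr rfl fun a _ => ?_
    rw [hsym a j, hGs a j]
    ring
  simp only [hs, featMean] at hg ⊢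
  rw [hg]
  simp only [mul_ite, mul_one, mul_zero,
      Finset.sum_ite_eq', Finset.mem_univ, if_true]
  ring
end
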